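/- Let ∼ be the equivalence relation on T × ℝ³ generated by: (i) (v,φ) ∼ (v, φ+u) for every u in the lattice L ⊂ ℝ³ generated by (4π,0,0), (0,4π,0), (0,0,4π), and (2π,2π,2π); (ii) for v = (x,y,z) ∈ T with x+y+z = π: (v,φ) ∼ (v, φ + t·(2π,2π,2π)) for all t ∈ ℝ; (iii) for v with x−y+z = π: (v,φ) ∼ (v, φ + t·(2π,−2π,2π)) for all t ∈ ℝ; (iv) for v with −x+y+z = π: (v,φ) ∼ (v, φ + t·(−2π,2π,2π)) for all t ∈ ℝ; (v) for v with x+y−z = π: (v,φ) ∼ (v, φ + t·(2π,2π,−2π)) for all t ∈ ℝ. Then the quotient topological space (T × ℝ³)/∼ is homeomorphic to ℂP³. -/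

import Mathlib

noncomputable section

open Real

/-- The solid tetrahedron `T` with vertices `(π,0,0)`, `(0,π,0)`, `(0,0,π)`, `(π,π,π)`. -/
def Tet : Set (ℝ × ℝ × ℝ) :=
  {p | π ≤ p.1 + p.2.1 + p.2.2 ∧ p.2.1 + p.2.2 ≤ p.1 + π ∧
       p.1 + p.2.2 ≤ p.2.1 + π ∧ p.1 + p.2.1 ≤ p.2.2 + π}

/-- `ℂ⁴` with its standard Hermitian norm. -/
abbrev C4 : Type := EuclideanSpace ℂ (Fin 4)

/-- The circle-action relation on the unit sphere of `ℂ⁴`. -/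
def CPRel (x y : ↥(Metric.sphere (0 : C4) 1)) : Prop :=
  ∃ z : ℂ, ‖z‖ = 1 ∧ (y : C4) = z • (x : C4)

/-- Complex projective 3-space, realized as the quotient of the unit sphere of `ℂ⁴`
by the scalar action of the circle group. -/
abbrev CP3 : Type := Quotient (Relation.EqvGen.setoid CPRel)

/-- The identification relation on `T × ℝ³`: fibers are identified by the lattice generated
by `(4π,0,0)`, `(0,4π,0)`, `(0,0,4π)`, `(2π,2π,2π)`, and over each facet of `T` also by the
line in the corresponding direction. -/
def TCRel (p q : ↥Tet × (ℝ × ℝ × ℝ)) : Prop :=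
  p.1 = q.1 ∧
    ((∃ a b c d : ℤ,
        q.2 = p.2 + a • ((4 * π, 0, 0) : ℝ × ℝ × ℝ) + b • ((0, 4 * π, 0) : ℝ × ℝ × ℝ)
          + c • ((0, 0, 4 * π) : ℝ × ℝ × ℝ) + d • ((2 * π, 2 * π, 2 * π) : ℝ × ℝ × ℝ)) ∨
     ((p.1 : ℝ × ℝ × ℝ).1 + (p.1 : ℝ × ℝ × ℝ).2.1 + (p.1 : ℝ × ℝ × ℝ).2.2 = π ∧
        ∃ t : ℝ, q.2 = p.2 + t • ((2 * π, 2 * π, 2 * π) : ℝ × ℝ × ℝ)) ∨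
     ((p.1 : ℝ × ℝ × ℝ).1 - (p.1 : ℝ × ℝ × ℝ).2.1 + (p.1 : ℝ × ℝ × ℝ).2.2 = π ∧
        ∃ t : ℝ, q.2 = p.2 + t • ((2 * π, -(2 * π), 2 * π) : ℝ × ℝ × ℝ)) ∨
     (-(p.1 : ℝ × ℝ × ℝ).1 + (p.1 : ℝ × ℝ × ℝ).2.1 + (p.1 : ℝ × ℝ × ℝ).2.2 = π ∧
        ∃ t : ℝ, q.2 = p.2 + t • ((-(2 * π), 2 * π, 2 * π) : ℝ × ℝ × ℝ)) ∨
     ((p.1 : ℝ × ℝ × ℝ).1 + (p.1 : ℝ × ℝ × ℝ).2.1 - (p.1 : ℝ × ℝ × ℝ).2.2 = π ∧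
        ∃ t : ℝ, q.2 = p.2 + t • ((2 * π, 2 * π, -(2 * π)) : ℝ × ℝ × ℝ)))

/-- The barycentric coordinates of a point with respect to the vertices of `Tet`; the `j`-th one
vanishes exactly on the `j`-th facet plane. -/
def bary (v : ℝ × ℝ × ℝ) : Fin 4 → ℝ :=
  ![(v.1 + v.2.1 + v.2.2 - π) / (2 * π), (π - (v.1 - v.2.1 + v.2.2)) / (2 * π),
    (π - (-v.1 + v.2.1 + v.2.2)) / (2 * π), (π - (v.1 + v.2.1 - v.2.2)) / (2 * π)]

/-- The phases of the homogeneous coordinates attached to a point of `ℝ³`. -/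
def phase (u : ℝ × ℝ × ℝ) : Fin 4 → ℝ :=
  ![0, (u.1 + u.2.2) / 2, (u.2.1 + u.2.2) / 2, (u.1 + u.2.1) / 2]

/-- The direction collapsed over the `j`-th facet. -/
def facetDir : Fin 4 → ℝ × ℝ × ℝ :=
  ![(2 * π, 2 * π, 2 * π), (2 * π, -(2 * π), 2 * π), (-(2 * π), 2 * π, 2 * π),
    (2 * π, 2 * π, -(2 * π))]

lemma bary_nonneg {v : ℝ × ℝ × ℝ} (hv : v ∈ Tet) (j : Fin 4) : 0 ≤ bary v j := by
  obtain ⟨h0, h1, h2, h3⟩ := hv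
  fin_cases j <;> simp only [bary] <;> refine div_nonneg ?_ two_pi_pos.le <;> linarith

lemma sum_bary (v : ℝ × ℝ × ℝ) : ∑ j, bary v j = 1 := by
  simp only [Fin.sum_univ_four, bary, Matrix.cons_val]
  field_simp
  ring

lemma bary_injective : Function.Injective bary := by
  rintro ⟨x, y, z⟩ ⟨x', y', z'⟩ h
  have h1 := congrFun h 1
  have h2 := congrFun h 2
  have h3 := congrFun h 3
  simp only [bary, Matrix.cons_val, div_left_inj' two_pi_pos.ne'] at h1 h2 h3
  ext <;> dsimp only <;> linarith

lemma exists_bary_eq {a : Fin 4 → ℝ} (ha : ∀ j, 0 ≤ a j) (hs : ∑ j, a j = 1) :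
    ∃ v ∈ Tet, bary v = a := by
  rw [Fin.sum_univ_four] at hs
  have h0 : a 0 = 1 - a 1 - a 2 - a 3 := by linarith
  have := pi_pos
  refine ⟨(π * (1 - a 1 - a 3), π * (1 - a 2 - a 3), π * (1 - a 1 - a 2)), ?_, ?_⟩
  · have k0 := mul_nonneg this.le (ha 0)
    have k1 := mul_nonneg this.le (ha 1)
    have k2 := mul_nonneg this.le (ha 2)
    have k3 := mul_nonneg this.le (ha 3)
    rw [h0] at k0
    refine ⟨?_, ?_, ?_, ?_⟩ <;> dsimp only <;> nlinarith
  · funext j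
    fin_cases j <;> simp [bary, h0] <;> field_simp <;> ring

lemma exists_phase_eq {s : Fin 4 → ℝ} (hs : s 0 = 0) : ∃ u, phase u = s := by
  refine ⟨(s 1 + s 3 - s 2, s 2 + s 3 - s 1, s 1 + s 2 - s 3), ?_⟩
  funext j
  fin_cases j <;> simp [phase, hs] <;> ring

@[fun_prop]
lemma continuous_bary (j : Fin 4) : Continuous fun v => bary v j := by
  fin_cases j <;> simp only [bary] <;> dsimp <;> fun_prop

@[fun_prop]
lemma continuous_phase (j : Fin 4) : Continuous fun u => phase u j := by
  fin_cases j <;> simp only [phase] <;> dsimp <;> fun_prop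

/-- Homogeneous coordinates with squared moduli `bary` and arguments `phase`. -/
def toSphere (p : ↥Tet × (ℝ × ℝ × ℝ)) : ↥(Metric.sphere (0 : C4) 1) :=
  ⟨WithLp.toLp 2 fun j => (√(bary p.1 j) : ℂ) * Complex.exp (phase p.2 j * Complex.I), by
    rw [mem_sphere_zero_iff_norm, EuclideanSpace.norm_eq, Real.sqrt_eq_one, ← sum_bary p.1]
    refine Finset.sum_congr rfl fun j _ => ?_
    simp [Complex.norm_exp_ofReal_mul_I, bary_nonneg p.1.2 j]⟩

lemma toSphere_apply (p : ↥Tet × (ℝ × ℝ × ℝ)) (j : Fin 4) :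
    (toSphere p : C4) j = (√(bary p.1 j) : ℂ) * Complex.exp (phase p.2 j * Complex.I) := rfl

lemma continuous_toSphere : Continuous toSphere := by
  refine Continuous.subtype_mk ?_ _
  fun_prop

lemma cpRel_equivalence : Equivalence CPRel where
  refl x := ⟨1, by simp, by simp⟩
  symm := by
    rintro x y ⟨z, hz, h⟩
    have hz0 : z ≠ 0 := norm_ne_zero_iff.1 (by simp [hz])
    exact ⟨z⁻¹, by simp [hz], by rw [h, inv_smul_smul₀ hz0]⟩
  trans := by
    rintro x y w ⟨z, hz, h⟩ ⟨z', hz', h'⟩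
    exact ⟨z' * z, by simp [hz, hz'], by rw [h', h, mul_smul]⟩

lemma CP3.mk_eq_mk_iff (x y : ↥(Metric.sphere (0 : C4) 1)) :
    (Quotient.mk _ x : CP3) = Quotient.mk _ y ↔ CPRel x y := by
  rw [Quotient.eq]
  exact cpRel_equivalence.eqvGen_iff

/-- The matrix entries of the rank one projection onto the line spanned by a unit vector. -/
def rankOne (x : ↥(Metric.sphere (0 : C4) 1)) (i j : Fin 4) : ℂ :=
  (x : C4) i * star ((x : C4) j)

lemma sum_star_mul_self (x : ↥(Metric.sphere (0 : C4) 1)) :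
    ∑ j, star ((x : C4) j) * (x : C4) j = 1 := by
  have h := mem_sphere_zero_iff_norm.1 x.2
  rw [EuclideanSpace.norm_eq, Real.sqrt_eq_one] at h
  have h' := congrArg (fun r : ℝ => (r : ℂ)) h
  push_cast at h'
  rw [← h']
  exact Finset.sum_congr rfl fun j _ => Complex.conj_mul' _

lemma rankOne_eq_iff (x y : ↥(Metric.sphere (0 : C4) 1)) :
    rankOne x = rankOne y ↔ CPRel x y := by
  constructor
  · intro h
    have hy : (y : C4) = (∑ j, star ((x : C4) j) * (y : C4) j) • (x : C4) := by
      ext i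
      calc (y : C4) i = ∑ j, rankOne y i j * (y : C4) j := by
            simp only [rankOne, mul_assoc, ← Finset.mul_sum, sum_star_mul_self, mul_one]
        _ = ∑ j, rankOne x i j * (y : C4) j := by rw [h]
        _ = _ := by
            simp only [rankOne, mul_assoc, ← Finset.mul_sum, PiLp.smul_apply, smul_eq_mul]
            ring
    refine ⟨_, ?_, hy⟩
    have hn := congrArg norm hy
    rw [norm_smul, mem_sphere_zero_iff_norm.1 x.2, mem_sphere_zero_iff_norm.1 y.2, mul_one] at hn
    exact hn.symm
  · rintro ⟨z, hz, h⟩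
    have hzz : z * star z = 1 := by
      rw [Complex.star_def, Complex.mul_conj', hz]; simp
    funext i j
    simp only [rankOne, h, PiLp.smul_apply, smul_eq_mul, star_mul]
    linear_combination (-(x : C4) i * star ((x : C4) j)) * hzz

instance : T2Space CP3 := by
  have hc : Continuous rankOne := by
    unfold rankOne
    fun_prop
  let F : CP3 → Fin 4 → Fin 4 → ℂ := Quotient.lift rankOne fun x y h =>
    (rankOne_eq_iff x y).2 (cpRel_equivalence.eqvGen_iff.1 h)
  refine T2Space.of_injective_continuous (f := F) ?_ (hc.quotient_lift _)
  rintro ⟨x⟩ ⟨y⟩ h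
  exact (CP3.mk_eq_mk_iff x y).2 ((rankOne_eq_iff x y).1 h)

lemma isCompact_tet : IsCompact Tet := by
  have hc : IsClosed Tet := by
    simp only [Tet, Set.ofPred_and]
    refine .inter ?_ (.inter ?_ (.inter ?_ ?_)) <;> exact isClosed_le (by fun_prop) (by fun_prop)
  refine (isCompact_Icc (a := ((0, 0, 0) : ℝ × ℝ × ℝ)) (b := (π, π, π))).of_isClosed_subset hc ?_
  rintro ⟨x, y, z⟩ ⟨h0, h1, h2, h3⟩
  dsimp only at h0 h1 h2 h3
  refine ⟨⟨?_, ?_, ?_⟩, ⟨?_, ?_, ?_⟩⟩ <;> dsimp only <;> linarith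

lemma tcRel_add_facetDir {v : ↥Tet} {j : Fin 4} {t : ℝ} (h : bary v j = 0 ∨ t = 0)
    (u : ℝ × ℝ × ℝ) : TCRel (v, u) (v, u + t • facetDir j) := by
  refine ⟨rfl, ?_⟩
  rcases h with h | rfl
  · have := two_pi_pos.ne'
    right
    fin_cases j <;>
      simp only [bary, Fin.zero_eta, Fin.mk_one, Fin.reduceFinMk, Matrix.cons_val, div_eq_zero_iff,
        this, or_false] at h
    · exact Or.inl ⟨by dsimp only; linarith, t, rfl⟩
    · exact Or.inr (Or.inl ⟨by dsimp only; linarith, t, rfl⟩)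
    · exact Or.inr (Or.inr (Or.inl ⟨by dsimp only; linarith, t, rfl⟩))
    · exact Or.inr (Or.inr (Or.inr ⟨by dsimp only; linarith, t, rfl⟩))
  · exact Or.inl ⟨0, 0, 0, 0, by simp⟩

lemma cpRel_toSphere_of_phase {v : ↥Tet} {u u' : ℝ × ℝ × ℝ} (θ : ℝ)
    (h : ∀ j, bary v j = 0 ∨ ∃ n : ℤ, phase u' j = θ + phase u j + n * (2 * π)) :
    CPRel (toSphere (v, u)) (toSphere (v, u')) := by
  refine ⟨Complex.exp (θ * Complex.I), Complex.norm_exp_ofReal_mul_I θ, ?_⟩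
  ext j
  rw [PiLp.smul_apply, toSphere_apply, toSphere_apply, smul_eq_mul]
  dsimp only
  rcases h j with h | ⟨n, h⟩
  · simp [h]
  · rw [mul_left_comm, ← Complex.exp_add]
    congr 1
    rw [Complex.exp_eq_exp_iff_exists_int]
    exact ⟨n, by rw [h]; push_cast; ring⟩

lemma cpRel_toSphere_of_tcRel {p q : ↥Tet × (ℝ × ℝ × ℝ)} (h : TCRel p q) :
    CPRel (toSphere p) (toSphere q) := by
  obtain ⟨v, x, y, z⟩ := p
  obtain ⟨v', u'⟩ := q
  obtain ⟨hv, h⟩ := h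
  obtain rfl : v = v' := hv
  dsimp only at h
  rcases h with ⟨a, b, c, d, rfl⟩ | ⟨hv, t, rfl⟩ | ⟨hv, t, rfl⟩ | ⟨hv, t, rfl⟩ | ⟨hv, t, rfl⟩
  · refine cpRel_toSphere_of_phase 0 fun j => Or.inr ⟨![0, a + c + d, b + c + d, a + b + d] j, ?_⟩
    fin_cases j <;> simp [phase] <;> ring
  · refine cpRel_toSphere_of_phase (t * (2 * π)) fun j => ?_
    fin_cases j
    · left
      simp [bary, hv]
    all_goals
      right
      refine ⟨0, ?_⟩
      simp [phase]
      ring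
  · refine cpRel_toSphere_of_phase 0 fun j => ?_
    fin_cases j
    · exact Or.inr ⟨0, by simp [phase]⟩
    · left; simp [bary, hv]
    · exact Or.inr ⟨0, by simp [phase]; ring⟩
    · exact Or.inr ⟨0, by simp [phase]; ring⟩
  · refine cpRel_toSphere_of_phase 0 fun j => ?_
    fin_cases j
    · exact Or.inr ⟨0, by simp [phase]⟩
    · exact Or.inr ⟨0, by simp [phase]; ring⟩
    · left; simp [bary, hv]
    · exact Or.inr ⟨0, by simp [phase]; ring⟩
  · refine cpRel_toSphere_of_phase 0 fun j => ?_
    fin_cases j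
    · exact Or.inr ⟨0, by simp [phase]⟩
    · exact Or.inr ⟨0, by simp [phase]; ring⟩
    · exact Or.inr ⟨0, by simp [phase]; ring⟩
    · left; simp [bary, hv]

lemma tcRel_of_phase {v : ↥Tet} {u u' : ℝ × ℝ × ℝ} (n : Fin 4 → ℤ)
    (h : ∀ j, phase u' j = phase u j + (n j - n 0) * (2 * π)) : TCRel (v, u) (v, u') := by
  refine ⟨rfl, Or.inl ⟨n 3 - n 2, n 3 - n 1, 0, n 1 + n 2 - n 3 - n 0, ?_⟩⟩
  have h1 := h 1
  have h2 := h 2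
  have h3 := h 3
  simp only [phase, Matrix.cons_val] at h1 h2 h3
  ext <;> simp <;> linarith

lemma phase_add_smul_facetDir (u : ℝ × ℝ × ℝ) (t : ℝ) (i j : Fin 4) :
    phase (u + t • facetDir i) j = phase u j +
      t * (2 * π) * (if i = 0 then (if j = 0 then 0 else 1) else if i = j then 1 else 0) := by
  fin_cases i <;> fin_cases j <;> simp [phase, facetDir] <;> ring

lemma eqvGen_of_phase {v : ↥Tet} {u u' : ℝ × ℝ × ℝ} (θ : ℝ) (n : Fin 4 → ℤ)
    (h : ∀ j, bary v j = 0 ∨ phase u' j = θ + phase u j + n j * (2 * π)) :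
    Relation.EqvGen TCRel (v, u) (v, u') := by
  let r : Fin 4 → ℝ := fun j => (phase u' j - phase u j - θ) / (2 * π) - n j
  have hr (j) : phase u' j = θ + phase u j + (n j + r j) * (2 * π) := by
    simp only [r]
    field_simp
    ring
  have hz (j) : bary v j = 0 ∨ r j = 0 := by
    refine (h j).imp_right fun h => ?_
    simp only [r, h]
    field_simp
    ring
  have hz0 : bary v 0 = 0 ∨ -r 0 = 0 := (hz 0).imp_right fun h => by simp [h]
  refine .trans _ _ _ (.rel _ _ (tcRel_add_facetDir hz0 _)) ?_
  refine .trans _ _ _ (.rel _ _ (tcRel_add_facetDir (hz 1) _)) ?_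
  refine .trans _ _ _ (.rel _ _ (tcRel_add_facetDir (hz 2) _)) ?_
  refine .trans _ _ _ (.rel _ _ (tcRel_add_facetDir (hz 3) _)) ?_
  refine .rel _ _ (tcRel_of_phase n fun j => ?_)
  have h0 := hr 0
  have hj := hr j
  simp only [phase_add_smul_facetDir]
  have hp (w) : phase w 0 = 0 := rfl
  rw [hp, hp] at h0
  fin_cases j <;> simp [hp] at hj ⊢ <;> linarith

lemma eqvGen_of_cpRel_toSphere {p q : ↥Tet × (ℝ × ℝ × ℝ)} (h : CPRel (toSphere p) (toSphere q)) :
    Relation.EqvGen TCRel p q := by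
  obtain ⟨v, u⟩ := p
  obtain ⟨v', u'⟩ := q
  obtain ⟨z, hz, h⟩ := h
  have hj (j) := congrArg (fun w : C4 => w j) h
  simp only [PiLp.smul_apply, toSphere_apply, smul_eq_mul] at hj
  obtain rfl : v = v' := by
    refine Subtype.ext (bary_injective (funext fun j => ?_))
    have hn := congrArg norm (hj j)
    simp only [norm_mul, hz, one_mul, Complex.norm_exp_ofReal_mul_I, mul_one, Complex.norm_real,
      norm_of_nonneg (sqrt_nonneg _)] at hn
    exact ((sqrt_inj (bary_nonneg v'.2 j) (bary_nonneg v.2 j)).1 hn).symm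
  have hex (j) : ∃ n : ℤ, bary v j = 0 ∨
      phase u' j = z.arg + phase u j + n * (2 * π) := by
    by_cases h0 : bary v j = 0
    · exact ⟨0, Or.inl h0⟩
    have hs : (√(bary v j) : ℂ) ≠ 0 := by
      simpa [sqrt_eq_zero (bary_nonneg v.2 j)] using h0
    have hz' : z = Complex.exp (z.arg * Complex.I) := by
      simpa [hz] using (Complex.norm_mul_exp_arg_mul_I z).symm
    have hj := hj j
    rw [mul_left_comm] at hj
    have he := mul_left_cancel₀ hs hj
    rw [hz', ← Complex.exp_add, Complex.exp_eq_exp_iff_exists_int] at he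
    obtain ⟨n, hn⟩ := he
    refine ⟨n, Or.inr ?_⟩
    have hI : ((phase u' j : ℝ) : ℂ) * Complex.I =
        ((z.arg + phase u j + n * (2 * π) : ℝ) : ℂ) * Complex.I := by
      rw [hn]; push_cast; ring
    exact_mod_cast mul_right_cancel₀ Complex.I_ne_zero hI
  choose n hn using hex
  exact eqvGen_of_phase z.arg n hn

lemma exists_cpRel_toSphere (x : ↥(Metric.sphere (0 : C4) 1)) : ∃ p, CPRel (toSphere p) x := by
  have hx := mem_sphere_zero_iff_norm.1 x.2
  rw [EuclideanSpace.norm_eq, Real.sqrt_eq_one] at hx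
  obtain ⟨v, hv, ha⟩ := exists_bary_eq (fun j => sq_nonneg ‖(x : C4) j‖) hx
  obtain ⟨u, hu⟩ := exists_phase_eq
    (s := fun j => ((x : C4) j).arg - ((x : C4) 0).arg) (sub_self _)
  refine ⟨(⟨v, hv⟩, u), Complex.exp (((x : C4) 0).arg * Complex.I),
    Complex.norm_exp_ofReal_mul_I _, ?_⟩
  ext j
  rw [PiLp.smul_apply, toSphere_apply, smul_eq_mul, mul_left_comm, ← Complex.exp_add]
  dsimp only
  rw [ha, hu, sqrt_sq (norm_nonneg _), ← add_mul]
  simp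

/-- Reducing each coordinate modulo `4π` yields representatives in a compact box. -/
lemma exists_tcRel_mem_Icc (v : ↥Tet) (u : ℝ × ℝ × ℝ) :
    ∃ u' ∈ Set.Icc ((0, 0, 0) : ℝ × ℝ × ℝ) (4 * π, 4 * π, 4 * π), TCRel (v, u') (v, u) := by
  have hp : (0 : ℝ) < 4 * π := by positivity
  refine ⟨(toIcoMod hp 0 u.1, toIcoMod hp 0 u.2.1, toIcoMod hp 0 u.2.2), ?_, rfl,
    Or.inl ⟨toIcoDiv hp 0 u.1, toIcoDiv hp 0 u.2.1, toIcoDiv hp 0 u.2.2, 0, ?_⟩⟩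
  · have hm (r : ℝ) := toIcoMod_mem_Ico' hp r
    exact ⟨⟨(hm _).1, (hm _).1, (hm _).1⟩, (hm _).2.le, (hm _).2.le, (hm _).2.le⟩
  · ext <;> simp [-zsmul_eq_mul, toIcoMod_add_toIcoDiv_zsmul]

instance : CompactSpace (Quotient (Relation.EqvGen.setoid TCRel)) := by
  have : CompactSpace ↥Tet := isCompact_iff_compactSpace.1 isCompact_tet
  refine ⟨?_⟩
  convert ((isCompact_univ (X := ↥Tet)).prod (isCompact_Icc (a := ((0, 0, 0) : ℝ × ℝ × ℝ))
    (b := (4 * π, 4 * π, 4 * π)))).image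
    (continuous_quotient_mk' (s := Relation.EqvGen.setoid TCRel))
  refine (Set.eq_univ_of_forall ?_).symm
  rintro ⟨v, u⟩
  obtain ⟨u', hu', h⟩ := exists_tcRel_mem_Icc v u
  exact ⟨(v, u'), ⟨trivial, hu'⟩, Quotient.sound (.rel _ _ h)⟩

/-- The map `(T × ℝ³)/∼ → ℂP³` induced by `toSphere`. -/
def tetQuotientToCP3 : Quotient (Relation.EqvGen.setoid TCRel) → CP3 :=
  Quotient.lift (fun p => Quotient.mk _ (toSphere p)) fun p q h =>
    (CP3.mk_eq_mk_iff _ _).2 <| cpRel_equivalence.eqvGen_iff.1 <| by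
      induction h with
      | rel p q h => exact .rel _ _ (cpRel_toSphere_of_tcRel h)
      | refl p => exact .refl _
      | symm p q _ ih => exact .symm _ _ ih
      | trans p q r _ _ ih₁ ih₂ => exact .trans _ _ _ ih₁ ih₂

lemma continuous_tetQuotientToCP3 : Continuous tetQuotientToCP3 :=
  (continuous_quotient_mk'.comp continuous_toSphere).quotient_lift _

lemma bijective_tetQuotientToCP3 : Function.Bijective tetQuotientToCP3 := by
  constructor
  · rintro ⟨p⟩ ⟨q⟩ h
    exact Quotient.sound (eqvGen_of_cpRel_toSphere ((CP3.mk_eq_mk_iff _ _).1 h))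
  · rintro ⟨x⟩
    obtain ⟨p, hp⟩ := exists_cpRel_toSphere x
    exact ⟨Quotient.mk _ p, (CP3.mk_eq_mk_iff _ _).2 hp⟩

/-- The quotient of `T × ℝ³` by the relation generated by the lattice and
facet identifications is homeomorphic to `ℂP³`. -/
theorem tet_torus_quotient_homeomorph_CP3 :
    Nonempty (Quotient (Relation.EqvGen.setoid TCRel) ≃ₜ CP3) :=
  ⟨Continuous.homeoOfEquivCompactToT2 (f := Equiv.ofBijective _ bijective_tetQuotientToCP3)
    continuous_tetQuotientToCP3⟩
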